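/- Write f_{ij} = {x_i, x_j}. For every i in {1,...,n} and every homogeneous element f of R, the element y_i ψ(f) - (-1)^{|x_i||f|} ψ(f) y_i - Σ_{s,t} (-1)^{|x_i||ψ_s(f)|} ψ_s(f) ψ_t(f_{is}) y_t - Σ_{s,t} (-1)^{|x_i||ψ_t(ψ_s(f))|} ψ_t(ψ_s(f)) f_{it} y_s of F(R) lies in the ideal J (here s, t range over {1,...,n}). -/

import Mathlib

noncomputable section

open scoped DirectSum

/-- The sign `(-1)^m`, as an integer, for `m : ℤ`. -/
def sgn (m : ℤ) : ℤ := (Int.negOnePow m : ℤ)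

/-- A differential graded Poisson algebra structure on a `ℤ`-graded `k`-algebra `A`,
whose grading is given by `𝒜`. -/
structure DGPoissonAlgebra (k : Type) [Field k] (A : Type) [Ring A] [Algebra k A]
    (𝒜 : ℤ → Submodule k A) : Type where
  /-- the Poisson bracket -/
  br : A →ₗ[k] A →ₗ[k] A
  /-- the differential -/
  d : A →ₗ[k] A
  br_mem : ∀ ⦃i j : ℤ⦄ ⦃a b : A⦄, a ∈ 𝒜 i → b ∈ 𝒜 j → br a b ∈ 𝒜 (i + j)
  d_mem : ∀ ⦃i : ℤ⦄ ⦃a : A⦄, a ∈ 𝒜 i → d a ∈ 𝒜 (i + 1)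
  antisymm : ∀ ⦃i j : ℤ⦄ ⦃a b : A⦄, a ∈ 𝒜 i → b ∈ 𝒜 j →
    br a b = -(sgn (i * j) • br b a)
  jacobi : ∀ ⦃i j l : ℤ⦄ ⦃a b c : A⦄, a ∈ 𝒜 i → b ∈ 𝒜 j → c ∈ 𝒜 l →
    br a (br b c) = br (br a b) c + sgn (i * j) • br b (br a c)
  gcomm : ∀ ⦃i j : ℤ⦄ ⦃a b : A⦄, a ∈ 𝒜 i → b ∈ 𝒜 j → a * b = sgn (i * j) • (b * a)
  leibniz : ∀ ⦃i j l : ℤ⦄ ⦃a b c : A⦄, a ∈ 𝒜 i → b ∈ 𝒜 j → c ∈ 𝒜 l →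
    br a (b * c) = br a b * c + sgn (i * j) • (b * br a c)
  d_sq : ∀ a : A, d (d a) = 0
  d_br : ∀ ⦃i j : ℤ⦄ ⦃a b : A⦄, a ∈ 𝒜 i → b ∈ 𝒜 j →
    d (br a b) = br (d a) b + sgn i • br a (d b)
  d_mul : ∀ ⦃i j : ℤ⦄ ⦃a b : A⦄, a ∈ 𝒜 i → b ∈ 𝒜 j →
    d (a * b) = d a * b + sgn i • (a * d b)

/-- A differential graded algebra structure (i.e. a differential) on a `ℤ`-graded
`k`-algebra `B` with grading `ℬ`. -/
structure DGAlgebra (k : Type) [Field k] (B : Type) [Ring B] [Algebra k B]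
    (ℬ : ℤ → Submodule k B) : Type where
  /-- the differential -/
  d : B →ₗ[k] B
  d_mem : ∀ ⦃i : ℤ⦄ ⦃b : B⦄, b ∈ ℬ i → d b ∈ ℬ (i + 1)
  d_sq : ∀ b : B, d (d b) = 0
  d_mul : ∀ ⦃i j : ℤ⦄ ⦃a b : B⦄, a ∈ ℬ i → b ∈ ℬ j →
    d (a * b) = d a * b + sgn i • (a * d b)

/-- `f` is a DG algebra map: a degree-`0` algebra map commuting with the differentials. -/
structure IsDGAlgebraMap (k : Type) [Field k] {A B : Type} [Ring A] [Algebra k A]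
    [Ring B] [Algebra k B] (𝒜 : ℤ → Submodule k A) (ℬ : ℤ → Submodule k B)
    (dA : A →ₗ[k] A) (dB : B →ₗ[k] B) (f : A →ₐ[k] B) : Prop where
  map_mem : ∀ ⦃i : ℤ⦄ ⦃a : A⦄, a ∈ 𝒜 i → f a ∈ ℬ i
  map_d : ∀ a : A, f (dA a) = dB (f a)

/-- The compatibility conditions satisfied by a pair `(f, g)` from a DG Poisson algebra
`A` to a DG algebra `B`: `f` is a DG algebra map, `g` is a degree-`0` `k`-linear map
commuting with the differentials which is a graded Lie algebra map into `B` with the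
graded commutator, and the two mixed identities hold. -/
def UEACompat (k : Type) [Field k] {A B : Type} [Ring A] [Algebra k A]
    [Ring B] [Algebra k B] (𝒜 : ℤ → Submodule k A) (ℬ : ℤ → Submodule k B)
    (P : DGPoissonAlgebra k A 𝒜) (dB : B →ₗ[k] B)
    (f : A →ₐ[k] B) (g : A →ₗ[k] B) : Prop :=
  IsDGAlgebraMap k 𝒜 ℬ P.d dB f ∧
  (∀ ⦃i : ℤ⦄ ⦃a : A⦄, a ∈ 𝒜 i → g a ∈ ℬ i) ∧
  (∀ a : A, g (P.d a) = dB (g a)) ∧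
  (∀ ⦃i j : ℤ⦄ ⦃a b : A⦄, a ∈ 𝒜 i → b ∈ 𝒜 j →
    g (P.br a b) = g a * g b - sgn (i * j) • (g b * g a)) ∧
  (∀ ⦃i j : ℤ⦄ ⦃a b : A⦄, a ∈ 𝒜 i → b ∈ 𝒜 j →
    f (P.br a b) = g a * f b - sgn (i * j) • (f b * g a)) ∧
  (∀ ⦃i j : ℤ⦄ ⦃a b : A⦄, a ∈ 𝒜 i → b ∈ 𝒜 j →
    g (a * b) = f a * g b + sgn (i * j) • (f b * g a))

/-- `(E, α, β)` is a universal enveloping algebra of the DG Poisson algebra `A`. -/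
def IsUEA (k : Type) [Field k] {A E : Type} [Ring A] [Algebra k A] [Ring E] [Algebra k E]
    (𝒜 : ℤ → Submodule k A) (ℰ : ℤ → Submodule k E)
    (P : DGPoissonAlgebra k A 𝒜) (DE : DGAlgebra k E ℰ)
    (α : A →ₐ[k] E) (β : A →ₗ[k] E) : Prop :=
  UEACompat k 𝒜 ℰ P DE.d α β ∧
  ∀ (D : Type) [Ring D] [Algebra k D] (𝒟 : ℤ → Submodule k D) [GradedAlgebra 𝒟]
    (dD : DGAlgebra k D 𝒟) (f : A →ₐ[k] D) (g : A →ₗ[k] D),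
    UEACompat k 𝒜 𝒟 P dD.d f g →
    ∃! φ : E →ₐ[k] D, IsDGAlgebraMap k ℰ 𝒟 DE.d dD.d φ ∧
      φ.comp α = f ∧ φ.toLinearMap.comp β = g

/-- The two-sided ideal of `F` generated by a set `S`, as a `k`-submodule. -/
def idealGen (k : Type) [Field k] {F : Type} [Ring F] [Algebra k F] (S : Set F) :
    Submodule k F :=
  Submodule.span k {z : F | ∃ u v : F, ∃ s ∈ S, z = u * s * v}

/-- The left ideal of `F` generated by a set `S`, as a `k`-submodule. -/
def leftIdealGen (k : Type) [Field k] {F : Type} [Ring F] [Algebra k F] (S : Set F) :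
    Submodule k F :=
  Submodule.span k {z : F | ∃ u : F, ∃ s ∈ S, z = u * s}

/-- A submodule is graded if it is spanned by its homogeneous elements. -/
def IsGradedSubmodule (k : Type) [Field k] {A : Type} [AddCommGroup A] [Module k A]
    (𝒜 : ℤ → Submodule k A) (M : Submodule k A) : Prop :=
  M ≤ Submodule.span k {a : A | a ∈ M ∧ ∃ i, a ∈ 𝒜 i}

/-- A `k`-submodule which is a two-sided ideal. -/
def IsTwoSidedIdealSub (k : Type) [Field k] {A : Type} [Ring A] [Algebra k A]
    (M : Submodule k A) : Prop :=
  ∀ r : A, ∀ m ∈ M, r * m ∈ M ∧ m * r ∈ M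

/-- A DG ideal: a graded two-sided ideal closed under the differential `d`. -/
def IsDGIdeal (k : Type) [Field k] {A : Type} [Ring A] [Algebra k A]
    (𝒜 : ℤ → Submodule k A) (d : A →ₗ[k] A) (M : Submodule k A) : Prop :=
  IsTwoSidedIdealSub k M ∧ IsGradedSubmodule k 𝒜 M ∧ ∀ m ∈ M, d m ∈ M

/-- A DG Poisson ideal: a DG ideal which is also closed under the Poisson bracket. -/
def IsDGPoissonIdeal (k : Type) [Field k] {A : Type} [Ring A] [Algebra k A]
    (𝒜 : ℤ → Submodule k A) (P : DGPoissonAlgebra k A 𝒜) (M : Submodule k A) : Prop :=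
  IsDGIdeal k 𝒜 P.d M ∧ ∀ a : A, ∀ m ∈ M, P.br a m ∈ M

/-- `π : A → B` presents `B` as the quotient of `A` by `I`. -/
structure IsQuotientBy (k : Type) [Field k] {A B : Type} [Ring A] [Algebra k A]
    [Ring B] [Algebra k B] (π : A →ₐ[k] B) (I : Submodule k A) : Prop where
  surj : Function.Surjective π
  ker : ∀ a : A, π a = 0 ↔ a ∈ I

/-- The (noncommutative, ordered) monomial `x 0 ^ e 0 * x 1 ^ e 1 * ⋯` . -/
def xMono {n : ℕ} {R : Type} [Ring R] (x : Fin n → R) (e : Fin n → ℕ) : R :=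
  ((List.finRange n).map fun r => x r ^ e r).prod
/-- The map `ψ : R → F(R)`, `ψ(f) = ∑_α ψ_α(f) y_α`. -/
def psiF {k R F : Type} [Field k] [Ring R] [Algebra k R] [Ring F] [Algebra k F]
    {Λ : Type} (ι : R →ₐ[k] F) (ψ : Λ → R →ₗ[k] R) (y : Λ → F) (f : R) : F :=
  ∑ᶠ α : Λ, ι (ψ α f) * y α

/-- The generators of the graded ideal `J` of `F(R)`: `I`, `ψ(I)`,
`y_i y_j - (-1)^{|x_i||x_j|} y_j y_i - ψ({x_i, x_j})` and
`y_i x_j - (-1)^{|x_i||x_j|} x_j y_i - {x_i, x_j}`. -/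
def Jgens {k R F : Type} [Field k] [Ring R] [Algebra k R] [Ring F] [Algebra k F]
    {Λ : Type} (𝒜 : ℤ → Submodule k R) (P : DGPoissonAlgebra k R 𝒜)
    (x : Λ → R) (w : Λ → ℤ) (ι : R →ₐ[k] F) (ψ : Λ → R →ₗ[k] R) (y : Λ → F)
    (I : Submodule k R) : Set F :=
  (⇑ι '' (I : Set R)) ∪ (psiF ι ψ y '' (I : Set R)) ∪
  {z | ∃ α β, z = y α * y β - sgn (w α * w β) • (y β * y α)
      - psiF ι ψ y (P.br (x α) (x β))} ∪
  {z | ∃ α β, z = y α * ι (x β) - sgn (w α * w β) • (ι (x β) * y α)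
      - ι (P.br (x α) (x β))}

theorem sgn_add (a b : ℤ) : sgn (a + b) = sgn a * sgn b := by
  simp [sgn, Int.negOnePow_add]

theorem sgn_zero : sgn 0 = 1 := by simp [sgn]

section idealGen

variable {k F : Type} [Field k] [Ring F] [Algebra k F] {S : Set F}

theorem subset_idealGen {z : F} (hz : z ∈ S) : z ∈ idealGen k S :=
  Submodule.subset_span ⟨1, 1, z, hz, by simp⟩

theorem mul_mem_idealGen_left (a : F) {z : F} (hz : z ∈ idealGen k S) :
    a * z ∈ idealGen k S := by
  refine (Submodule.span_le (p := (idealGen k S).comap (LinearMap.mulLeft k a))).2 ?_ hz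
  rintro _ ⟨u, v, s, hs, rfl⟩
  exact Submodule.subset_span ⟨a * u, v, s, hs, by simp [mul_assoc]⟩

theorem mul_mem_idealGen_right (a : F) {z : F} (hz : z ∈ idealGen k S) :
    z * a ∈ idealGen k S := by
  refine (Submodule.span_le (p := (idealGen k S).comap (LinearMap.mulRight k a))).2 ?_ hz
  rintro _ ⟨u, v, s, hs, rfl⟩
  exact Submodule.subset_span ⟨u, v * a, s, hs, by simp [mul_assoc]⟩

end idealGen

section Graded

variable {k R : Type} [Field k] [Ring R] [Algebra k R] {𝒜 : ℤ → Submodule k R}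
  [GradedAlgebra 𝒜] {Λ : Type} {x : Λ → R} {w : Λ → ℤ}

/-- A family of submodules which contains the homogeneous generators of a graded algebra and is
closed under products of homogeneous elements contains all homogeneous elements. -/
theorem homogeneous_le_of_generators (hx : ∀ i, x i ∈ 𝒜 (w i))
    (hgen : Algebra.adjoin k (Set.range x) = ⊤) (p : ℤ → Submodule k R)
    (one_mem : 1 ∈ p 0) (gen_mem : ∀ i, x i ∈ p (w i))
    (mul_mem : ∀ ⦃i j : ℤ⦄ ⦃a b : R⦄, a ∈ 𝒜 i → b ∈ 𝒜 j → a ∈ p i → b ∈ p j →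
      a * b ∈ p (i + j)) (m : ℤ) : 𝒜 m ≤ p m := by
  have monomial_mem : ∀ g ∈ Submonoid.closure (Set.range x), ∃ i, g ∈ 𝒜 i ∧ g ∈ p i := by
    intro g hg
    induction hg using Submonoid.closure_induction with
    | mem g hg =>
      obtain ⟨i, rfl⟩ := hg
      exact ⟨w i, hx i, gen_mem i⟩
    | one => exact ⟨0, SetLike.GradedOne.one_mem, one_mem⟩
    | mul a b _ _ ha hb =>
      obtain ⟨i, hai, hai'⟩ := ha
      obtain ⟨j, hbj, hbj'⟩ := hb
      exact ⟨i + j, SetLike.GradedMul.mul_mem hai hbj, mul_mem hai hbj hai' hbj'⟩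
  have component_mem : ∀ g : R, GradedAlgebra.proj 𝒜 m g ∈ p m := by
    intro g
    have hg : g ∈ Submodule.span k (Submonoid.closure (Set.range x) : Set R) := by
      rw [← Algebra.adjoin_eq_span, hgen]
      trivial
    induction hg using Submodule.span_induction with
    | mem g hg =>
      obtain ⟨i, hgi, hgi'⟩ := monomial_mem g hg
      rw [GradedAlgebra.proj_apply]
      by_cases h : i = m
      · subst h
        rwa [DirectSum.decompose_of_mem_same 𝒜 hgi]
      · rw [DirectSum.decompose_of_mem_ne 𝒜 hgi h]
        exact zero_mem _
    | zero => simp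
    | add a b _ _ ha hb => rw [map_add]; exact add_mem ha hb
    | smul c a _ ha => rw [map_smul]; exact Submodule.smul_mem _ _ ha
  intro g hg
  have := component_mem g
  rwa [GradedAlgebra.proj_apply, DirectSum.decompose_of_mem_same 𝒜 hg] at this

theorem DGPoissonAlgebra.br_one (P : DGPoissonAlgebra k R 𝒜) {i : ℤ} {a : R}
    (ha : a ∈ 𝒜 i) : P.br a 1 = 0 := by
  have h := P.leibniz ha (SetLike.GradedOne.one_mem (A := 𝒜)) (SetLike.GradedOne.one_mem (A := 𝒜))
  simpa [sgn_zero] using h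

/-- The bracket with a fixed homogeneous element, expanded in terms of anti-differentials. -/
theorem DGPoissonAlgebra.br_eq_sum [Fintype Λ] (P : DGPoissonAlgebra k R 𝒜)
    (hx : ∀ i, x i ∈ 𝒜 (w i)) (hgen : Algebra.adjoin k (Set.range x) = ⊤)
    (ψ : Λ → R →ₗ[k] R)
    (hψx : ∀ i, ψ i (x i) = 1) (hψx' : ∀ i j, i ≠ j → ψ i (x j) = 0)
    (hψmem : ∀ (r : Λ) ⦃i : ℤ⦄ ⦃a : R⦄, a ∈ 𝒜 i → ψ r a ∈ 𝒜 (i - w r))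
    (hψmul : ∀ (r : Λ) ⦃i j : ℤ⦄ ⦃a b : R⦄, a ∈ 𝒜 i → b ∈ 𝒜 j →
      ψ r (a * b) = a * ψ r b + sgn (i * j) • (b * ψ r a))
    {c : R} {d : ℤ} (hc : c ∈ 𝒜 d) {m : ℤ} {g : R} (hg : g ∈ 𝒜 m) :
    P.br c g = ∑ t, sgn (d * (m - w t)) • (ψ t g * P.br c (x t)) := by
  classical
  let δ : ℤ → R →ₗ[k] R := fun m =>
    ∑ t, sgn (d * (m - w t)) • (LinearMap.mulRight k (P.br c (x t)) ∘ₗ ψ t)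
  have hδ : ∀ m g, δ m g = ∑ t, sgn (d * (m - w t)) • (ψ t g * P.br c (x t)) := by
    intro m g
    simp [δ, LinearMap.sum_apply]
  suffices 𝒜 m ≤ LinearMap.eqLocus (P.br c) (δ m) by
    rw [← hδ]
    exact this hg
  refine homogeneous_le_of_generators hx hgen (fun m => LinearMap.eqLocus (P.br c) (δ m))
    ?_ ?_ ?_ m
  · have hψ1 : ∀ t, ψ t 1 = 0 := fun t => by
      simpa [sgn_zero] using
        hψmul t (SetLike.GradedOne.one_mem (A := 𝒜)) (SetLike.GradedOne.one_mem (A := 𝒜))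
    rw [LinearMap.mem_eqLocus, hδ, P.br_one hc]
    simp [hψ1]
  · intro i
    rw [LinearMap.mem_eqLocus, hδ, Finset.sum_eq_single i]
    · simp [hψx, sgn_zero]
    · intro t _ hti
      simp [hψx' t i hti]
    · simp
  · intro i j a b hai hbj ha hb
    rw [LinearMap.mem_eqLocus, hδ] at *
    rw [P.leibniz hc hai hbj, ha, hb, Finset.sum_mul, Finset.mul_sum, Finset.smul_sum,
      ← Finset.sum_add_distrib]
    refine Finset.sum_congr rfl fun t _ => ?_
    have hcomm := P.gcomm
      (SetLike.GradedMul.mul_mem (hψmem t hai) (P.br_mem hc (hx t))) hbj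
    have hsgn₁ : sgn (d * (i - w t)) * sgn ((i - w t + (d + w t)) * j) =
        sgn (d * (i + j - w t)) * sgn (i * j) := by
      rw [← sgn_add, ← sgn_add]
      congr 1
      ring
    have hsgn₂ : sgn (d * i) * sgn (d * (j - w t)) = sgn (d * (i + j - w t)) := by
      rw [← sgn_add]
      congr 1
      ring
    rw [hψmul t hai hbj, smul_mul_assoc, hcomm, mul_smul_comm, smul_smul, smul_smul,
      hsgn₁, hsgn₂, add_mul, smul_add, smul_mul_assoc, smul_smul, mul_assoc, mul_assoc,
      add_comm]

end Graded

/-- Writing `f_{ij} = {x_i, x_j}`, for every `i` and every homogeneous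
`f ∈ R`, the element
`y_i ψ(f) - (-1)^{|x_i||f|} ψ(f) y_i - ∑_{s,t} (-1)^{|x_i||ψ_s(f)|} ψ_s(f) ψ_t(f_{is}) y_t
 - ∑_{s,t} (-1)^{|x_i||ψ_t(ψ_s(f))|} ψ_t(ψ_s(f)) f_{it} y_s` of `F(R)` lies in `J`. -/
theorem stmt7 (k R F : Type) [Field k] [Ring R] [Algebra k R] [Ring F] [Algebra k F]
    (n : ℕ) (𝒜 : ℤ → Submodule k R) [GradedAlgebra 𝒜]
    (ℱ : ℤ → Submodule k F) [GradedAlgebra ℱ]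
    (P : DGPoissonAlgebra k R 𝒜)
    (x : Fin n → R) (w : Fin n → ℤ) (hx : ∀ i, x i ∈ 𝒜 (w i))
    (hgen : Algebra.adjoin k (Set.range x) = ⊤)
    (ψ : Fin n → R →ₗ[k] R)
    (hψx : ∀ i, ψ i (x i) = 1) (hψx' : ∀ i j, i ≠ j → ψ i (x j) = 0)
    (hψmem : ∀ (r : Fin n) ⦃i : ℤ⦄ ⦃a : R⦄, a ∈ 𝒜 i → ψ r a ∈ 𝒜 (i - w r))
    (hψmul : ∀ (r : Fin n) ⦃i j : ℤ⦄ ⦃a b : R⦄, a ∈ 𝒜 i → b ∈ 𝒜 j →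
      ψ r (a * b) = a * ψ r b + sgn (i * j) • (b * ψ r a))
    (ι : R →ₐ[k] F) (hι : ∀ ⦃i : ℤ⦄ ⦃a : R⦄, a ∈ 𝒜 i → ι a ∈ ℱ i)
    (y : Fin n → F) (hy : ∀ i, y i ∈ ℱ (w i))
    (I : Submodule k R) (hI : IsDGPoissonIdeal k 𝒜 P I) :
    ∀ (i : Fin n) ⦃l : ℤ⦄ ⦃f : R⦄, f ∈ 𝒜 l →
      y i * psiF ι ψ y f - sgn (w i * l) • (psiF ι ψ y f * y i)
          - (∑ s : Fin n, ∑ t : Fin n,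
              sgn (w i * (l - w s)) •
                (ι (ψ s f) * ι (ψ t (P.br (x i) (x s))) * y t))
          - (∑ s : Fin n, ∑ t : Fin n,
              sgn (w i * (l - w s - w t)) •
                (ι (ψ t (ψ s f)) * ι (P.br (x i) (x t)) * y s))
        ∈ idealGen k (Jgens 𝒜 P x w ι ψ y I) := by
  intro i l f hf
  set J := idealGen k (Jgens 𝒜 P x w ι ψ y I)
  have psiF_eq : ∀ g, psiF ι ψ y g = ∑ s, ι (ψ s g) * y s := fun g =>
    finsum_eq_sum_of_fintype _
  have hyy : ∀ s, y i * y s - sgn (w i * w s) • (y s * y i) - psiF ι ψ y (P.br (x i) (x s)) ∈ J :=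
    fun s => subset_idealGen (Or.inl (Or.inr ⟨i, s, rfl⟩))
  have hyx : ∀ s, y i * ι (x s) - sgn (w i * w s) • (ι (x s) * y i) - ι (P.br (x i) (x s)) ∈ J :=
    fun s => subset_idealGen (Or.inr ⟨i, s, rfl⟩)
  have hyg : ∀ m g, g ∈ 𝒜 m →
      y i * ι g - sgn (w i * m) • (ι g * y i) - ι (P.br (x i) g) ∈ J := by
    let T : ℤ → R →ₗ[k] F := fun m =>
      LinearMap.mulLeft k (y i) ∘ₗ ι.toLinearMap
        - sgn (w i * m) • (LinearMap.mulRight k (y i) ∘ₗ ι.toLinearMap)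
        - ι.toLinearMap ∘ₗ P.br (x i)
    have hT : ∀ m g, T m g =
        y i * ι g - sgn (w i * m) • (ι g * y i) - ι (P.br (x i) g) := by
      intro m g
      simp [T]
    intro m g hg
    rw [← hT]
    refine homogeneous_le_of_generators hx hgen (fun m => J.comap (T m)) ?_ ?_ ?_ m hg
    · rw [Submodule.mem_comap, hT, P.br_one (hx i)]
      simp [sgn_zero]
    · intro s
      rw [Submodule.mem_comap, hT]
      exact hyx s
    · intro p q a b hap hbq ha hb
      rw [Submodule.mem_comap, hT] at *
      convert add_mem (mul_mem_idealGen_right (ι b) ha)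
        (zsmul_mem (mul_mem_idealGen_left (ι a) hb) (sgn (w i * p))) using 1
      rw [P.leibniz (hx i) hap hbq, mul_add, sgn_add]
      simp only [map_mul, map_add, map_zsmul, sub_mul, mul_sub, smul_sub, smul_mul_assoc,
        mul_smul_comm, smul_smul, mul_assoc]
      abel
  have hterm : ∀ s, y i * (ι (ψ s f) * y s) - sgn (w i * l) • (ι (ψ s f) * y s * y i)
      - (∑ t, sgn (w i * (l - w s)) • (ι (ψ s f) * ι (ψ t (P.br (x i) (x s))) * y t))
      - (∑ t, sgn (w i * (l - w s - w t)) •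
          (ι (ψ t (ψ s f)) * ι (P.br (x i) (x t)) * y s)) ∈ J := by
    intro s
    convert add_mem (mul_mem_idealGen_right (y s) (hyg _ _ (hψmem s hf)))
      (zsmul_mem (mul_mem_idealGen_left (ι (ψ s f)) (hyy s)) (sgn (w i * (l - w s)))) using 1
    have hsgn : sgn (w i * l - w i * w s) * sgn (w i * w s) = sgn (w i * l) := by
      rw [← sgn_add, sub_add_cancel]
    rw [P.br_eq_sum hx hgen ψ hψx hψx' hψmem hψmul (hx i) (hψmem s hf), psiF_eq]
    simp only [map_sum, map_zsmul, map_mul, sub_mul, mul_sub, smul_sub, smul_mul_assoc,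
      mul_smul_comm, smul_smul, hsgn, Finset.sum_mul, Finset.mul_sum, Finset.smul_sum, mul_assoc]
    abel
  convert sum_mem (fun s (_ : s ∈ Finset.univ) => hterm s) using 1
  simp only [psiF_eq, Finset.sum_sub_distrib, Finset.mul_sum, Finset.sum_mul, Finset.smul_sum]
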